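/- (1) For every d > 2 and prime q ≥ d, there is a probability distribution over subsets A of F_q^d × [d] whose membership events are pairwise independent, with Pr[e ∈ A] = q^{−d} for every labeled vector e, E[|A|] = d, and E[rank(A)] ≤ 2 + d·q^{−d} < 3. (2) For every d > 2, there is a probability distribution over subsets A of F_2^d × [d] whose membership events are pairwise independent, with Pr[e ∈ A] = 2^{−d} for every labeled vector e, E[|A|] = d, and E[rank(A)] ≤ ⌈log₂ d⌉ + 1 + d·2^{−d} ≤ 3 + log₂ d. -/

import Mathlib

open scoped ENNReal

/-- The rank of a finite set of labeled vectors in `F_q^d × [d]`: the dimension of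
the span of its first coordinates. -/
noncomputable def labRank (q d : ℕ) [Fact q.Prime]
    (S : Finset ((Fin d → ZMod q) × Fin d)) : ℕ :=
  Module.finrank (ZMod q)
    (Submodule.span (ZMod q) (Prod.fst '' (S : Set ((Fin d → ZMod q) × Fin d))))

section UniformKernel

variable {K V W : Type*} [Field K] [AddCommGroup V] [Module K V] [AddCommGroup W] [Module K W]

/-- A surjective linear map vanishes at a uniformly random point with probability the inverse
of the size of its codomain. -/
theorem uniform_ker_of_surjective [Fintype V] [Finite W] (G : V →ₗ[K] W)
    (hG : Function.Surjective G) :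
    (PMF.uniformOfFintype V).toOuterMeasure {x | G x = 0} = (Nat.card W : ℝ≥0∞)⁻¹ := by
  classical
  have hcard : Nat.card V = Nat.card W * Nat.card (LinearMap.ker G) := by
    rw [Submodule.card_eq_card_quotient_mul_card (LinearMap.ker G), mul_comm,
      Nat.card_congr (G.quotKerEquivOfSurjective hG).toEquiv]
  have hker : Fintype.card {x | G x = 0} = Nat.card (LinearMap.ker G) := by
    rw [← Nat.card_eq_fintype_card]
    rfl
  have h0 : Nat.card (LinearMap.ker G) ≠ 0 := Nat.card_pos.ne'
  rw [PMF.toOuterMeasure_uniformOfFintype_apply, hker, ← Nat.card_eq_fintype_card, hcard]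
  push_cast
  rw [← ENNReal.inv_div (.inl (by simp)) (.inl (by exact_mod_cast h0)),
    ENNReal.mul_div_cancel_right (by exact_mod_cast h0) (by simp)]

end UniformKernel

section FinsetPMF

variable {α : Type*}

theorem PMF.tsum_mul_card [Fintype α] (D : PMF (Finset α)) :
    ∑' A, D A * (A.card : ℝ≥0∞) = ∑ e, D.toOuterMeasure {A | e ∈ A} := by
  classical
  rw [tsum_fintype]
  simp_rw [PMF.toOuterMeasure_apply_fintype]
  rw [Finset.sum_comm]
  refine Finset.sum_congr rfl fun A _ => ?_
  simp [Set.indicator_apply, mul_comm]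

theorem PMF.tsum_mul_le_add (D : PMF α) (f : α → ℕ) (m d : ℕ) (hd : ∀ a, f a ≤ d) :
    ∑' a, D a * (f a : ℝ≥0∞) ≤ m + d * D.toOuterMeasure {a | m < f a} := by
  classical
  have hm : ∑' a, D a * m = (m : ℝ≥0∞) := by rw [ENNReal.tsum_mul_right, D.tsum_coe, one_mul]
  rw [PMF.toOuterMeasure_apply, ← ENNReal.tsum_mul_left, ← hm, ← ENNReal.tsum_add]
  refine ENNReal.tsum_le_tsum fun a => ?_
  by_cases h : m < f a
  · rw [Set.indicator_of_mem (by exact h), mul_comm (d : ℝ≥0∞)]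
    exact le_add_left (by gcongr; exact hd a)
  · refine le_add_right ?_
    gcongr
    omega

end FinsetPMF

section HashSet

variable {q d k : ℕ} [Fact q.Prime] {K : Type*} [Field K] [Algebra (ZMod q) K]

/-- The `K`-linear functional `(a, u, w) ↦ u + ∑ l, t i l • w l - a * φ v` attached to a
labeled vector `(v, i)`. -/
noncomputable def hashMap (φ : (Fin d → ZMod q) ≃ₗ[ZMod q] K) (t : Fin d → Fin k → ZMod q)
    (e : (Fin d → ZMod q) × Fin d) : (K × K × (Fin k → K)) →ₗ[K] K where
  toFun x := x.2.1 + ∑ l, algebraMap (ZMod q) K (t e.2 l) * x.2.2 l - x.1 * φ e.1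
  map_add' x y := by
    simp only [Prod.fst_add, Prod.snd_add, Pi.add_apply, mul_add, add_mul, Finset.sum_add_distrib]
    ring
  map_smul' c x := by
    simp only [Prod.smul_fst, Prod.smul_snd, Pi.smul_apply, smul_eq_mul, RingHom.id_apply,
      mul_sub, mul_add, Finset.mul_sum, mul_assoc, mul_left_comm]

theorem hashMap_apply (φ : (Fin d → ZMod q) ≃ₗ[ZMod q] K) (t : Fin d → Fin k → ZMod q)
    (e : (Fin d → ZMod q) × Fin d) (x : K × K × (Fin k → K)) :
    hashMap φ t e x
      = x.2.1 + ∑ l, algebraMap (ZMod q) K (t e.2 l) * x.2.2 l - x.1 * φ e.1 := rfl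

theorem hashMap_surjective (φ : (Fin d → ZMod q) ≃ₗ[ZMod q] K) (t : Fin d → Fin k → ZMod q)
    (e : (Fin d → ZMod q) × Fin d) : Function.Surjective (hashMap φ t e) := fun y =>
  ⟨(0, y, 0), by simp [hashMap_apply]⟩

theorem hashMap_prod_surjective (φ : (Fin d → ZMod q) ≃ₗ[ZMod q] K) {t : Fin d → Fin k → ZMod q}
    (ht : Function.Injective t) {e f : (Fin d → ZMod q) × Fin d} (hef : e ≠ f) :
    Function.Surjective ((hashMap φ t e).prod (hashMap φ t f)) := by
  rintro ⟨x, y⟩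
  by_cases hi : e.2 = f.2
  · have hv : φ f.1 - φ e.1 ≠ 0 := fun h =>
      hef (Prod.ext (φ.injective (sub_eq_zero.1 h).symm) hi)
    refine ⟨((x - y) / (φ f.1 - φ e.1), x + (x - y) / (φ f.1 - φ e.1) * φ e.1, 0), ?_⟩
    ext
    · simp [hashMap_apply]
    · simp only [LinearMap.prod_apply, Function.prod_apply, hashMap_apply, Pi.zero_apply, mul_zero,
        Finset.sum_const_zero]
      field_simp
      ring
  · obtain ⟨l, hl⟩ := Function.ne_iff.1 (ht.ne hi)
    have hc : algebraMap (ZMod q) K (t e.2 l) - algebraMap (ZMod q) K (t f.2 l) ≠ 0 := fun h =>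
      hl ((algebraMap (ZMod q) K).injective (sub_eq_zero.1 h))
    set c := (x - y) / (algebraMap (ZMod q) K (t e.2 l) - algebraMap (ZMod q) K (t f.2 l))
      with hcdef
    have hsum : ∀ i, ∑ m, algebraMap (ZMod q) K (t i m) * (Pi.single l c : Fin k → K) m
        = algebraMap (ZMod q) K (t i l) * c := fun i => by
      rw [Finset.sum_eq_single l (fun m _ hm => by simp [hm]) (by simp), Pi.single_eq_same]
    refine ⟨(0, x - algebraMap (ZMod q) K (t e.2 l) * c, Pi.single l c), ?_⟩
    ext
    · simp [hashMap_apply, hsum]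
    · simp only [LinearMap.prod_apply, Function.prod_apply, hashMap_apply, hsum, zero_mul]
      rw [hcdef]
      field_simp
      ring

open Classical in
/-- The set of labeled vectors on which `hashMap` vanishes at the sample point `x`. -/
noncomputable def hashSet (φ : (Fin d → ZMod q) ≃ₗ[ZMod q] K) (t : Fin d → Fin k → ZMod q)
    (x : K × K × (Fin k → K)) : Finset ((Fin d → ZMod q) × Fin d) :=
  Finset.univ.filter fun e => hashMap φ t e x = 0

theorem mem_hashSet {φ : (Fin d → ZMod q) ≃ₗ[ZMod q] K} {t : Fin d → Fin k → ZMod q}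
    {x : K × K × (Fin k → K)} {e : (Fin d → ZMod q) × Fin d} :
    e ∈ hashSet φ t x ↔ hashMap φ t e x = 0 := by
  simp [hashSet]

theorem labRank_le (S : Finset ((Fin d → ZMod q) × Fin d)) : labRank q d S ≤ d := by
  simpa [labRank] using Submodule.finrank_le
    (Submodule.span (ZMod q) (Prod.fst '' (S : Set ((Fin d → ZMod q) × Fin d))))

theorem labRank_hashSet_le (φ : (Fin d → ZMod q) ≃ₗ[ZMod q] K) (t : Fin d → Fin k → ZMod q)
    {x : K × K × (Fin k → K)} (hx : x.1 ≠ 0) : labRank q d (hashSet φ t x) ≤ k + 1 := by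
  let b : Option (Fin k) → (Fin d → ZMod q) := fun o =>
    o.elim (φ.symm (x.1⁻¹ * x.2.1)) fun l => φ.symm (x.1⁻¹ * x.2.2 l)
  have hsub : Submodule.span (ZMod q)
      (Prod.fst '' (hashSet φ t x : Set ((Fin d → ZMod q) × Fin d)))
      ≤ Submodule.span (ZMod q) (Set.range b) := by
    rw [Submodule.span_le]
    rintro _ ⟨e, he, rfl⟩
    rw [Finset.mem_coe, mem_hashSet, hashMap_apply, sub_eq_zero] at he
    have hv : e.1 = b none + ∑ l, t e.2 l • b (some l) := by
      apply φ.injective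
      simp only [b, Option.elim, map_add, map_sum, map_smul, LinearEquiv.apply_symm_apply]
      simp only [Algebra.smul_def, mul_left_comm _ x.1⁻¹]
      rw [← Finset.mul_sum, ← mul_add, he, inv_mul_cancel_left₀ hx]
    rw [hv]
    exact add_mem (Submodule.subset_span ⟨none, rfl⟩)
      (sum_mem fun l _ => Submodule.smul_mem _ _ (Submodule.subset_span ⟨some l, rfl⟩))
  refine (Submodule.finrank_mono hsub).trans ((finrank_range_le_card b).trans ?_)
  simp

end HashSet

/-- If `d ≤ q ^ k`, some pairwise independent distribution of sets of labeled vectors with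
marginals `q ^ (-d)` has expected rank at most `k + 1 + d * q ^ (-d)`. -/
theorem exists_pairwise_indep_rank_le (d q k : ℕ) [Fact q.Prime] (hd : d ≠ 0) (hk : d ≤ q ^ k) :
    ∃ D : PMF (Finset ((Fin d → ZMod q) × Fin d)),
      (∀ e f : (Fin d → ZMod q) × Fin d, e ≠ f →
        D.toOuterMeasure {A | e ∈ A ∧ f ∈ A}
          = D.toOuterMeasure {A | e ∈ A} * D.toOuterMeasure {A | f ∈ A}) ∧
      (∀ e : (Fin d → ZMod q) × Fin d,
        D.toOuterMeasure {A | e ∈ A} = ((q : ℝ≥0∞) ^ d)⁻¹) ∧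
      (∑' A, D A * (A.card : ℝ≥0∞)) = d ∧
      (∑' A, D A * (labRank q d A : ℝ≥0∞)) ≤ (k + 1 : ℝ≥0∞) + d * ((q : ℝ≥0∞) ^ d)⁻¹ := by
  classical
  let K := GaloisField q d
  let _ : Fintype K := Fintype.ofFinite K
  have hK : (Nat.card K : ℝ≥0∞) = (q : ℝ≥0∞) ^ d := by
    rw [GaloisField.card q d hd]
    push_cast
    rfl
  let φ : (Fin d → ZMod q) ≃ₗ[ZMod q] K :=
    LinearEquiv.ofFinrankEq _ _ (by rw [Module.finrank_fin_fun, GaloisField.finrank q hd])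
  obtain ⟨t, ht⟩ : ∃ t : Fin d → Fin k → ZMod q, Function.Injective t := by
    obtain ⟨t⟩ := Function.Embedding.nonempty_of_card_le
      (α := Fin d) (β := Fin k → ZMod q) (by simpa [ZMod.card] using hk)
    exact ⟨t, t.injective⟩
  let U := PMF.uniformOfFintype (K × K × (Fin k → K))
  let D := U.map (hashSet φ t)
  have hmarg : ∀ e, D.toOuterMeasure {A | e ∈ A} = ((q : ℝ≥0∞) ^ d)⁻¹ := fun e => by
    rw [← hK, ← uniform_ker_of_surjective _ (hashMap_surjective φ t e),
      PMF.toOuterMeasure_map_apply]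
    simp only [Set.preimage_ofPred_eq, mem_hashSet]
    rfl
  refine ⟨D, fun e f hef => ?_, hmarg, ?_, ?_⟩
  · have h := uniform_ker_of_surjective _ (hashMap_prod_surjective φ ht hef)
    rw [hmarg, hmarg, PMF.toOuterMeasure_map_apply]
    simp only [Set.preimage_ofPred_eq, mem_hashSet]
    simp only [LinearMap.prod_apply, Function.prod_apply, Prod.mk_eq_zero, Nat.card_prod, Nat.cast_mul] at h
    rw [← hK, ← ENNReal.mul_inv (by simp) (by simp)]
    exact h
  · rw [PMF.tsum_mul_card, Finset.sum_congr rfl fun e _ => hmarg e]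
    have hq : (q : ℝ≥0∞) ^ d ≠ 0 := by simp [(Fact.out : q.Prime).ne_zero]
    have hq' : (q : ℝ≥0∞) ^ d ≠ ∞ := by simp
    simp only [Finset.sum_const, Finset.card_univ, Fintype.card_prod, Fintype.card_fun,
      ZMod.card, Fintype.card_fin, nsmul_eq_mul, Nat.cast_mul, Nat.cast_pow]
    rw [mul_comm, ← mul_assoc, ENNReal.inv_mul_cancel hq hq', one_mul]
  · refine (D.tsum_mul_le_add (labRank q d) (k + 1) d labRank_le).trans ?_
    push_cast
    gcongr
    rw [← hK, ← uniform_ker_of_surjective (LinearMap.fst K K (K × (Fin k → K)))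
      LinearMap.fst_surjective, PMF.toOuterMeasure_map_apply]
    refine MeasureTheory.measure_mono fun x hx => ?_
    by_contra hne
    exact absurd (labRank_hashSet_le φ t hne) (not_le.2 hx)

theorem natCast_clog_two_le (d : ℕ) (hd : 2 ≤ d) :
    (Nat.clog 2 d : ℝ≥0∞) ≤ 1 + ENNReal.ofReal (Real.logb 2 d) := by
  have hpos : (0 : ℝ) < d := by positivity
  have h1 : (2 : ℝ) ^ (Nat.clog 2 d - 1) ≤ d := by
    exact_mod_cast (Nat.pow_pred_clog_lt_self (by norm_num : 1 < 2) (by omega)).le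
  have h2 : ((Nat.clog 2 d - 1 : ℕ) : ℝ) ≤ Real.logb 2 d := by
    rw [Real.le_logb_iff_rpow_le (by norm_num) hpos, Real.rpow_natCast]
    exact h1
  calc (Nat.clog 2 d : ℝ≥0∞) ≤ ((1 + (Nat.clog 2 d - 1) : ℕ) : ℝ≥0∞) := by
        gcongr
        omega
    _ = 1 + ENNReal.ofReal ((Nat.clog 2 d - 1 : ℕ) : ℝ) := by
        rw [ENNReal.ofReal_natCast]
        push_cast
        rfl
    _ ≤ _ := by gcongr

theorem natCast_mul_inv_pow_lt_one {d q : ℕ} (hq : 1 < q) :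
    (d : ℝ≥0∞) * ((q : ℝ≥0∞) ^ d)⁻¹ < 1 := by
  rw [← div_eq_mul_inv, ENNReal.div_lt_iff (by simp [show q ≠ 0 by omega]) (by simp), one_mul]
  exact_mod_cast Nat.lt_pow_self hq

/-- (1) For every `d > 2` and prime `q ≥ d` there is a distribution over subsets `A`
of `F_q^d × [d]` with pairwise independent membership events, marginals `q^{−d}`,
`E[|A|] = d` and `E[rank(A)] ≤ 2 + d·q^{−d} < 3`.
(2) For every `d > 2` there is a distribution over subsets `A` of `F_2^d × [d]` with
pairwise independent membership events, marginals `2^{−d}`, `E[|A|] = d` and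
`E[rank(A)] ≤ ⌈log₂ d⌉ + 1 + d·2^{−d} ≤ 3 + log₂ d`. -/
theorem stmt7 :
    (∀ (d q : ℕ) [Fact q.Prime], 2 < d → d ≤ q →
      ∃ D : PMF (Finset ((Fin d → ZMod q) × Fin d)),
        (∀ e f : (Fin d → ZMod q) × Fin d, e ≠ f →
          D.toOuterMeasure {A | e ∈ A ∧ f ∈ A}
            = D.toOuterMeasure {A | e ∈ A} * D.toOuterMeasure {A | f ∈ A}) ∧
        (∀ e : (Fin d → ZMod q) × Fin d,
          D.toOuterMeasure {A | e ∈ A} = ((q : ℝ≥0∞) ^ d)⁻¹) ∧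
        (∑' A, D A * (A.card : ℝ≥0∞)) = d ∧
        (∑' A, D A * (labRank q d A : ℝ≥0∞)) ≤ 2 + d * ((q : ℝ≥0∞) ^ d)⁻¹ ∧
        (2 + d * ((q : ℝ≥0∞) ^ d)⁻¹ : ℝ≥0∞) < 3) ∧
    (∀ d : ℕ, 2 < d →
      ∃ D : PMF (Finset ((Fin d → ZMod 2) × Fin d)),
        (∀ e f : (Fin d → ZMod 2) × Fin d, e ≠ f →
          D.toOuterMeasure {A | e ∈ A ∧ f ∈ A}
            = D.toOuterMeasure {A | e ∈ A} * D.toOuterMeasure {A | f ∈ A}) ∧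
        (∀ e : (Fin d → ZMod 2) × Fin d,
          D.toOuterMeasure {A | e ∈ A} = ((2 : ℝ≥0∞) ^ d)⁻¹) ∧
        (∑' A, D A * (A.card : ℝ≥0∞)) = d ∧
        (∑' A, D A * (labRank 2 d A : ℝ≥0∞))
            ≤ (Nat.clog 2 d + 1 : ℝ≥0∞) + d * ((2 : ℝ≥0∞) ^ d)⁻¹ ∧
        ((Nat.clog 2 d + 1 : ℝ≥0∞) + d * ((2 : ℝ≥0∞) ^ d)⁻¹ : ℝ≥0∞)
            ≤ 3 + ENNReal.ofReal (Real.logb 2 d)) := by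
  refine ⟨fun d q _ hd hdq => ?_, fun d hd => ?_⟩
  · obtain ⟨D, h1, h2, h3, h4⟩ :=
      exists_pairwise_indep_rank_le d q 1 (by omega) (by simpa using hdq)
    refine ⟨D, h1, h2, h3, ?_, ?_⟩
    · rwa [Nat.cast_one, one_add_one_eq_two] at h4
    · calc (2 + d * ((q : ℝ≥0∞) ^ d)⁻¹ : ℝ≥0∞) < 2 + 1 :=
          ENNReal.add_lt_add_left (by simp) (natCast_mul_inv_pow_lt_one (by omega))
        _ = 3 := by norm_num
  · obtain ⟨D, h1, h2, h3, h4⟩ := exists_pairwise_indep_rank_le d 2 (Nat.clog 2 d) (by omega)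
      (Nat.le_pow_clog (by norm_num) d)
    refine ⟨D, h1, by simpa using h2, h3, by simpa using h4, ?_⟩
    have hlt := (natCast_mul_inv_pow_lt_one (d := d) (q := 2) (by norm_num)).le
    calc (Nat.clog 2 d + 1 : ℝ≥0∞) + d * ((2 : ℝ≥0∞) ^ d)⁻¹
        ≤ ((1 + ENNReal.ofReal (Real.logb 2 d)) + 1) + 1 := by
          gcongr
          · exact natCast_clog_two_le d hd.le
          · simpa using hlt
      _ = 3 + ENNReal.ofReal (Real.logb 2 d) := by ring
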